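/- Let d ≥ 1 be an integer, 1 ≤ p < ∞, 1 ≤ v < ∞. Suppose there is a constant c > 0 such that for every n ∈ ℕ the prior concentrations satisfy α_{j,b_n} ≥ 0 and Σ_{j ∈ {1,…,b_n}^d} α_{j,b_n} ≤ c·n^{1/2} when d ≤ 2v, and Σ_j α_{j,b_n} ≤ c·n^{1−v/d} when d > 2v. For each n and each j ∈ {1,…,b_n}^d, pick an arbitrary point x_j ∈ A_{j,b_n}, and define the discretized estimator P̃_n = Σ_{j} π̂_j · δ_{x_j}, where π̂_j = (α_{j,b_n} + N_j)/(n + Σ_i α_{i,b_n}) are the posterior mean histogram weights and δ_x denotes the point mass at x. Then there exist C > 0 (depending only on d, v, p, c) and N ≥ 2 such that for all n ≥ N, every Borel probability measure P₀ on [0,1)^d, and Y₁,…,Y_n i.i.d. with law P₀: E[W_v(P₀, P̃_n)] ≤ C·n^{−1/(2v)} if d < 2v; E[W_v(P₀, P̃_n)] ≤ C·n^{−1/(2v)}·(log n)^{1/v} if d = 2v; and E[W_v(P₀, P̃_n)] ≤ C·n^{−1/d} if d > 2v. -/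

import Mathlib

open MeasureTheory Filter
open scoped ENNReal NNReal Classical BigOperators

noncomputable section

/-- ℓ^p distance on ℝ^d. -/
def lpDist (p : ℝ) {d : ℕ} (x y : Fin d → ℝ) : ℝ :=
  (∑ l, |x l - y l| ^ p) ^ (1 / p)

/-- Wasserstein-v distance with respect to the ℓ^p metric, via couplings. -/
def wassersteinLp (p v : ℝ) {d : ℕ} (μ ν : Measure (Fin d → ℝ)) : ℝ :=
  sInf { r : ℝ | ∃ π : Measure ((Fin d → ℝ) × (Fin d → ℝ)),
      IsProbabilityMeasure π ∧ π.map Prod.fst = μ ∧ π.map Prod.snd = ν ∧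
      r = ∫ z, lpDist p z.1 z.2 ^ v ∂π } ^ (1 / v)

/-- The cube [0,1)^d. -/
def cube (d : ℕ) : Set (Fin d → ℝ) := {x | ∀ l, 0 ≤ x l ∧ x l < 1}

/-- The bin A_{i,b} (0-indexed): ∏_l [i_l/b, (i_l+1)/b). -/
def binSet (d b : ℕ) (i : Fin d → Fin b) : Set (Fin d → ℝ) :=
  {x | ∀ l, (i l : ℝ) / b ≤ x l ∧ x l < ((i l : ℝ) + 1) / b}

/-- Histogram probability measure with weights `w`: density Σ_i b^d w_i 1_{A_{i,b}}. -/
def histMeasure (d b : ℕ) (w : (Fin d → Fin b) → ℝ) : Measure (Fin d → ℝ) :=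
  volume.withDensity fun x =>
    ENNReal.ofReal (∑ i, (b : ℝ) ^ d * w i * Set.indicator (binSet d b i) 1 x)

/-- k_n = n^{1/(2v)} if d ≤ 2v, else n^{1/d}. -/
def kSeq (d : ℕ) (v : ℝ) (n : ℕ) : ℝ :=
  if (d : ℝ) ≤ 2 * v then (n : ℝ) ^ ((1 : ℝ) / (2 * v)) else (n : ℝ) ^ ((1 : ℝ) / d)

/-- K_n = ⌈log₂ k_n⌉. -/
def KSeq (d : ℕ) (v : ℝ) (n : ℕ) : ℕ := ⌈Real.logb 2 (kSeq d v n)⌉₊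

/-- b_n = 2^{K_n}. -/
def bSeq (d : ℕ) (v : ℝ) (n : ℕ) : ℕ := 2 ^ KSeq d v n

/-- Bin count N_j. -/
def binCount (d b : ℕ) {n : ℕ} (Y : Fin n → Fin d → ℝ) (j : Fin d → Fin b) : ℕ :=
  (Finset.univ.filter fun t => Y t ∈ binSet d b j).card

/-- Posterior mean weights π̂_j = (α_j + N_j)/(n + Σ_i α_i). -/
def postWeight (d b : ℕ) {n : ℕ} (α : (Fin d → Fin b) → ℝ) (Y : Fin n → Fin d → ℝ)
    (j : Fin d → Fin b) : ℝ :=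
  (α j + binCount d b Y j) / (n + ∑ i, α i)

/-- The posterior mean histogram P̄_n. -/
def postMeanHist (d : ℕ) (v : ℝ) {n : ℕ} (α : (Fin d → Fin (bSeq d v n)) → ℝ)
    (Y : Fin n → Fin d → ℝ) : Measure (Fin d → ℝ) :=
  histMeasure d (bSeq d v n) (postWeight d (bSeq d v n) α Y)

/-- Dirichlet(β) as the law of normalized independent Gammas. -/
def dirichlet {ι : Type*} [Fintype ι] (β : ι → ℝ) : Measure (ι → ℝ) :=
  (Measure.pi fun i => ProbabilityTheory.gammaMeasure (β i) 1).map
    fun g i => g i / ∑ j, g j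


/-- The discretized posterior mean histogram P̃_n = Σ_j π̂_j δ_{x_j}. -/
def discretizedHist (d b : ℕ) {n : ℕ} (α : (Fin d → Fin b) → ℝ) (Y : Fin n → Fin d → ℝ)
    (x : (Fin d → Fin b) → Fin d → ℝ) : Measure (Fin d → ℝ) :=
  ∑ j, ENNReal.ofReal (postWeight d b α Y j) • Measure.dirac (x j)

/-- A product-type sub-coupling inside each fibre of `g` that exhausts one of the two marginals
on that fibre. -/
lemma exists_saturating_subcoupling {ι β : Type*} [Fintype ι] (g : ι → β) (r s : ι → ℝ)
    (hr : ∀ i, 0 ≤ r i) (hs : ∀ i, 0 ≤ s i) :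
    ∃ u : ι → ι → ℝ, (∀ i j, 0 ≤ u i j) ∧ (∀ i j, g i ≠ g j → u i j = 0) ∧
      (∀ i, ∑ j, u i j ≤ r i) ∧ (∀ j, ∑ i, u i j ≤ s j) ∧
      ∀ i j, g i = g j → ∑ j', u i j' = r i ∨ ∑ i', u i' j = s j := by
  set R : β → ℝ := fun b => ∑ i, if g i = b then r i else 0 with hR
  set S : β → ℝ := fun b => ∑ i, if g i = b then s i else 0 with hS
  have hrR : ∀ i, r i ≤ R (g i) := fun i => by
    have := Finset.single_le_sum (f := fun k => if g k = g i then r k else 0)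
      (fun k _ => by split_ifs <;> simp [hr]) (Finset.mem_univ i)
    simpa using this
  have hsS : ∀ i, s i ≤ S (g i) := fun i => by
    have := Finset.single_le_sum (f := fun k => if g k = g i then s k else 0)
      (fun k _ => by split_ifs <;> simp [hs]) (Finset.mem_univ i)
    simpa using this
  have hR0 : ∀ b, 0 ≤ R b := fun b => Finset.sum_nonneg fun k _ => by split_ifs <;> simp [hr]
  have hS0 : ∀ b, 0 ≤ S b := fun b => Finset.sum_nonneg fun k _ => by split_ifs <;> simp [hs]
  set M : β → ℝ := fun b => max (R b) (S b) with hM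
  have hM0 : ∀ b, 0 ≤ M b := fun b => le_max_of_le_left (hR0 b)
  set u : ι → ι → ℝ := fun i j => if g i = g j then r i * s j / M (g i) else 0 with hu
  have hrow : ∀ i, ∑ j, u i j = r i * (S (g i) / M (g i)) := by
    intro i
    simp only [hu, hS, Finset.sum_div, Finset.mul_sum]
    refine Finset.sum_congr rfl fun j _ => ?_
    by_cases h : g i = g j
    · simp [h, mul_div_assoc]
    · simp [h, Ne.symm h]
  have hcol : ∀ j, ∑ i, u i j = s j * (R (g j) / M (g j)) := by
    intro j
    simp only [hu, hR, Finset.sum_div, Finset.mul_sum]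
    refine Finset.sum_congr rfl fun i _ => ?_
    by_cases h : g i = g j
    · simp only [h, if_true]; ring
    · simp [h]
  refine ⟨u, ?_, ?_, ?_, ?_, ?_⟩
  · intro i j
    simp only [hu]
    split_ifs
    · exact div_nonneg (mul_nonneg (hr i) (hs j)) (hM0 _)
    · rfl
  · intro i j h
    simp [hu, h]
  · intro i
    rw [hrow]
    exact mul_le_of_le_one_right (hr i) (div_le_one_of_le₀ (le_max_right _ _) (hM0 _))
  · intro j
    rw [hcol]
    exact mul_le_of_le_one_right (hs j) (div_le_one_of_le₀ (le_max_left _ _) (hM0 _))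
  · intro i j h
    rw [hrow, hcol, h]
    rcases le_total (R (g j)) (S (g j)) with h1 | h1
    · left
      have e : M (g j) = S (g j) := max_eq_right h1
      rw [e]
      rcases (hS0 (g j)).eq_or_lt with h2 | h2
      · have : r i = 0 := le_antisymm ((hrR i).trans (by rw [h, h2]; exact h1)) (hr i)
        simp [this]
      · rw [div_self h2.ne', mul_one]
    · right
      have e : M (g j) = R (g j) := max_eq_left h1
      rw [e]
      rcases (hR0 (g j)).eq_or_lt with h2 | h2
      · have : s j = 0 := le_antisymm ((hsS j).trans (by rw [h2]; exact h1)) (hs j)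
        simp [this]
      · rw [div_self h2.ne', mul_one]

/-- The `ℓ¹` discrepancy between the push-forwards of two weight vectors along `g`. -/
def fiberDiscrepancy {ι β : Type*} [Fintype ι] (g : ι → β) (m w : ι → ℝ) : ℝ :=
  ∑ b ∈ Finset.univ.image g,
    |∑ i ∈ Finset.univ.filter (fun i => g i = b), m i -
      ∑ i ∈ Finset.univ.filter (fun i => g i = b), w i|

lemma fiberDiscrepancy_nonneg {ι β : Type*} [Fintype ι] (g : ι → β) (m w : ι → ℝ) :
    0 ≤ fiberDiscrepancy g m w :=
  Finset.sum_nonneg fun _ _ => abs_nonneg _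

lemma sum_residual_le_fiberDiscrepancy {ι β : Type*} [Fintype ι] (g : ι → β) (m w : ι → ℝ)
    (q : ι → ι → ℝ) (hsupp : ∀ i j, g i ≠ g j → q i j = 0)
    (hsat : ∀ i j, g i = g j → ∑ j', q i j' = m i ∨ ∑ i', q i' j = w j) :
    ∑ i, (m i - ∑ j, q i j) ≤ fiberDiscrepancy g m w := by
  rw [← Finset.sum_fiberwise_of_maps_to (s := Finset.univ) (t := Finset.univ.image g) (g := g)
    (fun i _ => Finset.mem_image_of_mem g (Finset.mem_univ i))]
  refine Finset.sum_le_sum fun b _ => ?_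
  set F := Finset.univ.filter (fun i => g i = b) with hF
  have hmem : ∀ i, i ∈ F ↔ g i = b := fun i => by simp [hF]
  by_cases hall : ∀ i ∈ F, ∑ j, q i j = m i
  · rw [Finset.sum_eq_zero fun i hi => by rw [hall i hi, sub_self]]
    exact abs_nonneg _
  · push Not at hall
    obtain ⟨i₀, hi₀, hne⟩ := hall
    have hcol : ∀ j ∈ F, ∑ i, q i j = w j := fun j hj =>
      (hsat i₀ j (((hmem _).1 hi₀).trans ((hmem _).1 hj).symm)).resolve_left hne
    have hrow : ∑ i ∈ F, ∑ j, q i j = ∑ i ∈ F, ∑ j ∈ F, q i j :=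
      Finset.sum_congr rfl fun i hi => (Finset.sum_subset (Finset.subset_univ F) fun j _ hj =>
        hsupp i j fun h => hj ((hmem _).2 (h ▸ (hmem _).1 hi))).symm
    have hcol' : ∑ j ∈ F, ∑ i, q i j = ∑ j ∈ F, ∑ i ∈ F, q i j :=
      Finset.sum_congr rfl fun j hj => (Finset.sum_subset (Finset.subset_univ F) fun i _ hi =>
        hsupp i j fun h => hi ((hmem _).2 (h.trans ((hmem _).1 hj)))).symm
    rw [Finset.sum_sub_distrib, hrow, Finset.sum_comm, ← hcol', Finset.sum_congr rfl hcol]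
    exact le_abs_self _

/-- Greedy sub-coupling along a chain of coarser and coarser partitions. -/
lemma exists_hierarchical_subcoupling {ι β : Type*} [Fintype ι] (g : ℕ → ι → β)
    (hg : ∀ t i j, g t i = g t j → g (t + 1) i = g (t + 1) j) (m w : ι → ℝ)
    (hm : ∀ i, 0 ≤ m i) (hw : ∀ i, 0 ≤ w i) (c : ι → ι → ℝ) (δ : ℕ → ℝ) (hδ0 : ∀ t, 0 ≤ δ t)
    (hδ : ∀ t i j, g t i = g t j → c i j ≤ δ t) (T : ℕ) :
    ∃ q : ι → ι → ℝ, (∀ i j, 0 ≤ q i j) ∧ (∀ i j, g T i ≠ g T j → q i j = 0) ∧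
      (∀ i, ∑ j, q i j ≤ m i) ∧ (∀ j, ∑ i, q i j ≤ w j) ∧
      (∀ i j, g T i = g T j → ∑ j', q i j' = m i ∨ ∑ i', q i' j = w j) ∧
      ∑ i, ∑ j, q i j * c i j ≤
        δ 0 * ∑ i, m i + ∑ t ∈ Finset.range T, δ (t + 1) * fiberDiscrepancy (g t) m w := by
  have hcost : ∀ (t : ℕ) (u : ι → ι → ℝ) (r : ι → ℝ), (∀ i j, 0 ≤ u i j) →
      (∀ i j, g t i ≠ g t j → u i j = 0) → (∀ i, ∑ j, u i j ≤ r i) →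
      ∑ i, ∑ j, u i j * c i j ≤ δ t * ∑ i, r i := by
    intro t u r h0 hs hr
    rw [Finset.mul_sum]
    refine Finset.sum_le_sum fun i _ => ?_
    refine le_trans ?_ (mul_le_mul_of_nonneg_left (hr i) (hδ0 t))
    rw [Finset.mul_sum]
    refine Finset.sum_le_sum fun j _ => ?_
    by_cases h : g t i = g t j
    · rw [mul_comm]
      exact mul_le_mul_of_nonneg_right (hδ t i j h) (h0 i j)
    · simp [hs i j h]
  induction T with
  | zero =>
    obtain ⟨u, h0, hs, hr, hc, hsat⟩ := exists_saturating_subcoupling (g 0) m w hm hw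
    exact ⟨u, h0, hs, hr, hc, hsat, by simpa using hcost 0 u m h0 hs hr⟩
  | succ T ih =>
    obtain ⟨q, q0, qs, qr, qc, qsat, qcost⟩ := ih
    obtain ⟨u, h0, hs, hr, hc, hsat⟩ := exists_saturating_subcoupling (g (T + 1))
      (fun i => m i - ∑ j, q i j) (fun j => w j - ∑ i, q i j)
      (fun i => sub_nonneg.2 (qr i)) (fun j => sub_nonneg.2 (qc j))
    refine ⟨fun i j => q i j + u i j, fun i j => add_nonneg (q0 i j) (h0 i j), ?_, ?_, ?_, ?_, ?_⟩
    · intro i j h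
      simp [hs i j h, qs i j fun h' => h (hg T i j h')]
    · intro i
      rw [Finset.sum_add_distrib]
      linarith [hr i]
    · intro j
      rw [Finset.sum_add_distrib]
      linarith [hc j]
    · intro i j h
      rw [Finset.sum_add_distrib, Finset.sum_add_distrib]
      rcases hsat i j h with h' | h'
      · left; linarith
      · right; linarith
    · simp only [add_mul, Finset.sum_add_distrib]
      rw [Finset.sum_range_succ]
      have h1 := hcost (T + 1) u _ h0 hs hr
      have h2 := mul_le_mul_of_nonneg_left
        (sum_residual_le_fiberDiscrepancy (g T) m w q qs qsat) (hδ0 (T + 1))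
      linarith

/-- When the last partition is trivial and the total masses agree, the greedy sub-coupling is a
coupling. -/
lemma exists_hierarchical_coupling {ι β : Type*} [Fintype ι] (g : ℕ → ι → β)
    (hg : ∀ t i j, g t i = g t j → g (t + 1) i = g (t + 1) j) (m w : ι → ℝ)
    (hm : ∀ i, 0 ≤ m i) (hw : ∀ i, 0 ≤ w i) (hmw : ∑ i, m i = ∑ i, w i)
    (c : ι → ι → ℝ) (δ : ℕ → ℝ) (hδ0 : ∀ t, 0 ≤ δ t)
    (hδ : ∀ t i j, g t i = g t j → c i j ≤ δ t) (T : ℕ) (hT : ∀ i j, g T i = g T j) :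
    ∃ q : ι → ι → ℝ, (∀ i j, 0 ≤ q i j) ∧
      (∀ i, ∑ j, q i j = m i) ∧ (∀ j, ∑ i, q i j = w j) ∧
      ∑ i, ∑ j, q i j * c i j ≤
        δ 0 * ∑ i, m i + ∑ t ∈ Finset.range T, δ (t + 1) * fiberDiscrepancy (g t) m w := by
  obtain ⟨q, q0, -, qr, qc, qsat, qcost⟩ :=
    exists_hierarchical_subcoupling g hg m w hm hw c δ hδ0 hδ T
  have hcomm : ∑ i, ∑ j, q i j = ∑ j, ∑ i, q i j := Finset.sum_comm
  have hiff : (∀ i, ∑ j, q i j = m i) ↔ ∀ j, ∑ i, q i j = w j := by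
    have e1 := Finset.sum_eq_sum_iff_of_le (s := Finset.univ) fun i _ => qr i
    have e2 := Finset.sum_eq_sum_iff_of_le (s := Finset.univ) fun j _ => qc j
    simp only [Finset.mem_univ, true_implies] at e1 e2
    rw [← e1, ← e2, hcomm, hmw]
  have hrow : ∀ i, ∑ j, q i j = m i := by
    by_contra hne
    have hne' := hne
    push Not at hne
    obtain ⟨i, hi⟩ := hne
    exact hne' (hiff.2 fun j => (qsat i j (hT i j)).resolve_left hi)
  exact ⟨q, q0, hrow, hiff.1 hrow, qcost⟩

lemma measurableSet_binSet (d b : ℕ) (i : Fin d → Fin b) : MeasurableSet (binSet d b i) := by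
  have : binSet d b i = Set.univ.pi fun l => Set.Ico ((i l : ℝ) / b) (((i l : ℝ) + 1) / b) := by
    ext y; simp [binSet, Set.mem_pi]
  rw [this]
  exact MeasurableSet.univ_pi fun _ => measurableSet_Ico

lemma eq_of_mem_binSet {d b : ℕ} {i j : Fin d → Fin b} {y : Fin d → ℝ}
    (hi : y ∈ binSet d b i) (hj : y ∈ binSet d b j) : i = j := by
  funext l
  have hb : (0 : ℝ) < b := by exact_mod_cast (i l).pos
  have h1 := hi l
  have h2 := hj l
  rw [div_le_iff₀ hb, lt_div_iff₀ hb] at h1 h2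
  have h3 : ((i l : ℕ) : ℝ) < (j l : ℕ) + 1 := by linarith
  have h4 : ((j l : ℕ) : ℝ) < (i l : ℕ) + 1 := by linarith
  norm_cast at h3 h4
  ext
  omega

lemma exists_mem_binSet_of_mem_cube {d b : ℕ} (hb : 0 < b) {y : Fin d → ℝ} (hy : y ∈ cube d) :
    ∃ i, y ∈ binSet d b i := by
  have hb' : (0 : ℝ) < b := by exact_mod_cast hb
  refine ⟨fun l => ⟨⌊y l * b⌋₊, ?_⟩, fun l => ?_⟩
  · rw [Nat.floor_lt (mul_nonneg (hy l).1 hb'.le)]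
    exact mul_lt_of_lt_one_left hb' (hy l).2
  · rw [div_le_iff₀ hb', lt_div_iff₀ hb']
    exact ⟨Nat.floor_le (mul_nonneg (hy l).1 hb'.le), Nat.lt_floor_add_one _⟩

lemma measurableSet_cube (d : ℕ) : MeasurableSet (cube d) := by
  have : cube d = Set.univ.pi fun _ => Set.Ico (0 : ℝ) 1 := by
    ext y; simp [cube, Set.mem_pi]
  rw [this]
  exact MeasurableSet.univ_pi fun _ => measurableSet_Ico

lemma ae_mem_cube {d : ℕ} (μ : Measure (Fin d → ℝ)) [IsProbabilityMeasure μ]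
    (hμ : μ (cube d) = 1) : ∀ᵐ y ∂μ, y ∈ cube d :=
  (mem_ae_iff_prob_eq_one (measurableSet_cube d)).2 hμ

lemma lpDist_nonneg (p : ℝ) {d : ℕ} (x y : Fin d → ℝ) : 0 ≤ lpDist p x y :=
  Real.rpow_nonneg (Finset.sum_nonneg fun _ _ => Real.rpow_nonneg (abs_nonneg _) _) _

lemma lpDist_le {p : ℝ} (hp : 0 < p) {d : ℕ} {x y : Fin d → ℝ} {δ : ℝ} (hδ : 0 ≤ δ)
    (h : ∀ l, |x l - y l| ≤ δ) : lpDist p x y ≤ (d : ℝ) ^ (1 / p) * δ := by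
  have h1 : ∑ l, |x l - y l| ^ p ≤ d * δ ^ p := by
    calc ∑ l, |x l - y l| ^ p ≤ ∑ _l : Fin d, δ ^ p :=
          Finset.sum_le_sum fun l _ => Real.rpow_le_rpow (abs_nonneg _) (h l) hp.le
      _ = d * δ ^ p := by simp
  calc lpDist p x y ≤ (d * δ ^ p) ^ (1 / p) :=
        Real.rpow_le_rpow (Finset.sum_nonneg fun _ _ => Real.rpow_nonneg (abs_nonneg _) _) h1
          (by positivity)
    _ = (d : ℝ) ^ (1 / p) * δ := by
        rw [Real.mul_rpow (by positivity) (by positivity), ← Real.rpow_mul hδ,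
          mul_one_div_cancel hp.ne', Real.rpow_one]

lemma measurable_lpDist (p : ℝ) (d : ℕ) :
    Measurable fun z : (Fin d → ℝ) × (Fin d → ℝ) => lpDist p z.1 z.2 := by
  unfold lpDist
  refine Measurable.pow_const (Finset.measurable_sum _ fun l _ => Measurable.pow_const ?_ _) _
  exact (((measurable_pi_apply l).comp measurable_fst).sub
    ((measurable_pi_apply l).comp measurable_snd)).abs

lemma wassersteinLp_nonneg (p v : ℝ) {d : ℕ} (μ ν : Measure (Fin d → ℝ)) :
    0 ≤ wassersteinLp p v μ ν := by
  refine Real.rpow_nonneg (Real.sInf_nonneg ?_) _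
  rintro r ⟨π, -, -, -, rfl⟩
  exact integral_nonneg fun z => Real.rpow_nonneg (lpDist_nonneg _ _ _) _

lemma wassersteinLp_le_of_lintegral_le {p v : ℝ} (hv : 0 < v) {d : ℕ}
    {μ ν : Measure (Fin d → ℝ)} (π : Measure ((Fin d → ℝ) × (Fin d → ℝ)))
    (hπ : IsProbabilityMeasure π) (h1 : π.map Prod.fst = μ) (h2 : π.map Prod.snd = ν)
    {B : ℝ} (hB : 0 ≤ B)
    (h : ∫⁻ z, ENNReal.ofReal (lpDist p z.1 z.2 ^ v) ∂π ≤ ENNReal.ofReal B) :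
    wassersteinLp p v μ ν ≤ B ^ (1 / v) := by
  have hnn : ∀ z : (Fin d → ℝ) × (Fin d → ℝ), 0 ≤ lpDist p z.1 z.2 ^ v :=
    fun z => Real.rpow_nonneg (lpDist_nonneg _ _ _) _
  refine Real.rpow_le_rpow (Real.sInf_nonneg ?_) ?_ (by positivity)
  · rintro r ⟨π, -, -, -, rfl⟩
    exact integral_nonneg hnn
  · refine le_trans (csInf_le ⟨0, ?_⟩ ⟨π, hπ, h1, h2, rfl⟩) ?_
    · rintro r ⟨π, -, -, -, rfl⟩
      exact integral_nonneg hnn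
    · rw [integral_eq_lintegral_of_nonneg_ae (Eventually.of_forall hnn)
        ((measurable_lpDist p d).pow_const v).aestronglyMeasurable]
      exact ENNReal.toReal_le_of_le_ofReal hB h

/-- A coupling of bin masses lifts to a coupling of a measure with a discrete measure charging one
point per bin. -/
lemma wassersteinLp_le_of_coupling {p v : ℝ} (hv : 0 < v) {d : ℕ} {ι : Type*} [Fintype ι]
    (μ : Measure (Fin d → ℝ)) [IsProbabilityMeasure μ] (A : ι → Set (Fin d → ℝ))
    (hA : ∀ i, MeasurableSet (A i)) (hdisj : Pairwise (Function.onFun Disjoint A))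
    (hcov : ∀ᵐ y ∂μ, ∃ i, y ∈ A i) (x : ι → Fin d → ℝ) (w : ι → ℝ)
    (c : ι → ι → ℝ) (hc : ∀ i j, ∀ y ∈ A i, lpDist p y (x j) ^ v ≤ c i j)
    (hc0 : ∀ i j, 0 ≤ c i j)
    (q : ι → ι → ℝ) (q0 : ∀ i j, 0 ≤ q i j) (hrow : ∀ i, ∑ j, q i j = μ.real (A i))
    (hcol : ∀ j, ∑ i, q i j = w j) :
    wassersteinLp p v μ (∑ j, ENNReal.ofReal (w j) • Measure.dirac (x j)) ≤
      (∑ i, ∑ j, q i j * c i j) ^ (1 / v) := by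
  set π : Measure ((Fin d → ℝ) × (Fin d → ℝ)) :=
    ∑ i, ∑ j, ENNReal.ofReal (q i j) •
      (ProbabilityTheory.cond μ (A i)).map (fun y => (y, x j)) with hπ
  have hmeas : ∀ j, Measurable fun y : Fin d → ℝ => (y, x j) := fun j => by fun_prop
  have hfst : π.map Prod.fst = μ := by
    ext s hs
    rw [Measure.map_apply measurable_fst hs]
    have e : ∀ i, ∑ j, ENNReal.ofReal (q i j) * ProbabilityTheory.cond μ (A i) s
        = μ (A i ∩ s) := by
      intro i
      rw [← Finset.sum_mul, ← ENNReal.ofReal_sum_of_nonneg fun j _ => q0 i j, hrow,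
        ofReal_measureReal, mul_comm, ProbabilityTheory.cond_mul_eq_inter (hA i)]
    simp only [hπ, Measure.finsetSum_apply, Measure.smul_apply, smul_eq_mul]
    calc _ = ∑ i, ∑ j, ENNReal.ofReal (q i j) * ProbabilityTheory.cond μ (A i) s := by
          refine Finset.sum_congr rfl fun i _ => Finset.sum_congr rfl fun j _ => ?_
          rw [Measure.map_apply (hmeas j) (measurable_fst hs)]
          rfl
      _ = ∑ i, μ (A i ∩ s) := Finset.sum_congr rfl fun i _ => e i
      _ = μ (⋃ i, A i ∩ s) := by
          rw [measure_iUnion (fun i j hij => (hdisj hij).mono Set.inter_subset_left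
            Set.inter_subset_left) fun i => (hA i).inter hs, tsum_fintype]
      _ = μ s := by
          refine measure_congr ?_
          filter_upwards [hcov] with y hy
          apply propext
          obtain ⟨i, hi⟩ := hy
          change y ∈ (⋃ i, A i ∩ s) ↔ y ∈ s
          simp only [Set.mem_iUnion, Set.mem_inter_iff]
          exact ⟨fun ⟨_, _, h⟩ => h, fun h => ⟨i, hi, h⟩⟩
  have hprob : IsProbabilityMeasure π := by
    constructor
    have := congrArg (fun ρ : Measure (Fin d → ℝ) => ρ Set.univ) hfst
    simpa [Measure.map_apply measurable_fst MeasurableSet.univ] using this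
  have hsnd : π.map Prod.snd = ∑ j, ENNReal.ofReal (w j) • Measure.dirac (x j) := by
    ext s hs
    rw [Measure.map_apply measurable_snd hs]
    simp only [hπ, Measure.finsetSum_apply, Measure.smul_apply, smul_eq_mul]
    rw [Finset.sum_comm]
    refine Finset.sum_congr rfl fun j _ => ?_
    rw [← hcol j, ENNReal.ofReal_sum_of_nonneg fun i _ => q0 i j, Finset.sum_mul]
    refine Finset.sum_congr rfl fun i _ => ?_
    rw [Measure.map_apply (hmeas j) (measurable_snd hs), Measure.dirac_apply' _ hs]
    by_cases h0 : μ (A i) = 0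
    · have : q i j = 0 := by
        have h1 : ∑ j, q i j = 0 := by rw [hrow i, measureReal_def, h0]; rfl
        exact (Finset.sum_eq_zero_iff_of_nonneg fun j _ => q0 i j).1 h1 j (Finset.mem_univ j)
      simp [this]
    · have := ProbabilityTheory.cond_isProbabilityMeasure h0
      congr 1
      by_cases hj : x j ∈ s
      · have : (fun y : Fin d → ℝ => (y, x j)) ⁻¹' (Prod.snd ⁻¹' s) = Set.univ := by
          ext y; simp [hj]
        simp [this, hj]
      · have : (fun y : Fin d → ℝ => (y, x j)) ⁻¹' (Prod.snd ⁻¹' s) = ∅ := by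
          ext y; simp [hj]
        simp [this, hj]
  refine wassersteinLp_le_of_lintegral_le hv π hprob hfst hsnd
    (Finset.sum_nonneg fun i _ => Finset.sum_nonneg fun j _ => mul_nonneg (q0 i j) (hc0 i j)) ?_
  have hcm : Measurable fun z : (Fin d → ℝ) × (Fin d → ℝ) =>
      ENNReal.ofReal (lpDist p z.1 z.2 ^ v) :=
    ((measurable_lpDist p d).pow_const v).ennreal_ofReal
  rw [ENNReal.ofReal_sum_of_nonneg fun i _ =>
    Finset.sum_nonneg fun j _ => mul_nonneg (q0 i j) (hc0 i j)]
  simp only [hπ, lintegral_finsetSum_measure, lintegral_smul_measure, smul_eq_mul]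
  refine Finset.sum_le_sum fun i _ => ?_
  rw [ENNReal.ofReal_sum_of_nonneg fun j _ => mul_nonneg (q0 i j) (hc0 i j)]
  refine Finset.sum_le_sum fun j _ => ?_
  rw [ENNReal.ofReal_mul (q0 i j)]
  gcongr
  rw [lintegral_map hcm (hmeas j)]
  calc _ ≤ ∫⁻ _, ENNReal.ofReal (c i j) ∂(ProbabilityTheory.cond μ (A i)) := by
        refine lintegral_mono_ae ?_
        filter_upwards [ProbabilityTheory.ae_cond_mem (hA i)] with y hy
        exact ENNReal.ofReal_le_ofReal (hc i j y hy)
    _ ≤ ENNReal.ofReal (c i j) := by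
        rw [lintegral_const]
        by_cases h0 : μ (A i) = 0
        · simp [ProbabilityTheory.cond, Measure.restrict_eq_zero.2 h0]
        · have := ProbabilityTheory.cond_isProbabilityMeasure h0
          simp

/-- The index of the dyadic ancestor, `t` levels up, of a bin at level `K`. -/
def dyadicAncestor (d K t : ℕ) (i : Fin d → Fin (2 ^ K)) : Fin d → ℕ := fun l => (i l : ℕ) / 2 ^ t

lemma card_image_dyadicAncestor_le (d K t : ℕ) (ht : t ≤ K) :
    (Finset.univ.image (dyadicAncestor d K t)).card ≤ (2 ^ d) ^ (K - t) := by
  have hsub : Finset.univ.image (dyadicAncestor d K t) ⊆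
      Fintype.piFinset fun _ : Fin d => Finset.range (2 ^ (K - t)) := by
    intro a ha
    obtain ⟨i, -, rfl⟩ := Finset.mem_image.1 ha
    simp only [Fintype.mem_piFinset, Finset.mem_range, dyadicAncestor]
    intro l
    rw [Nat.div_lt_iff_lt_mul (by positivity), ← pow_add, Nat.sub_add_cancel ht]
    exact (i l).isLt
  refine (Finset.card_le_card hsub).trans (le_of_eq ?_)
  simp [← pow_mul, mul_comm]

lemma dyadicAncestor_succ {d K t : ℕ} {i j : Fin d → Fin (2 ^ K)}
    (h : dyadicAncestor d K t i = dyadicAncestor d K t j) :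
    dyadicAncestor d K (t + 1) i = dyadicAncestor d K (t + 1) j := by
  funext l
  have := congrFun h l
  simp only [dyadicAncestor] at this ⊢
  rw [pow_succ, ← Nat.div_div_eq_div_mul, this, Nat.div_div_eq_div_mul]

lemma dyadicAncestor_self (d K : ℕ) (i : Fin d → Fin (2 ^ K)) : dyadicAncestor d K K i = 0 := by
  funext l
  exact Nat.div_eq_of_lt (i l).isLt

lemma abs_sub_le_of_dyadicAncestor_eq {d K t : ℕ} {i j : Fin d → Fin (2 ^ K)}
    (h : dyadicAncestor d K t i = dyadicAncestor d K t j) {x y : Fin d → ℝ}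
    (hx : x ∈ binSet d (2 ^ K) i) (hy : y ∈ binSet d (2 ^ K) j) (l : Fin d) :
    |x l - y l| ≤ (1 / 2) ^ (K - t) := by
  wlog ht : t ≤ K generalizing t
  · have := this (t := K) (by rw [dyadicAncestor_self, dyadicAncestor_self]) le_rfl
    rw [Nat.sub_self] at this
    rwa [Nat.sub_eq_zero_of_le (le_of_not_ge ht)]
  have h2 : (0 : ℝ) < 2 ^ K := by positivity
  have hi := hx l
  have hj := hy l
  have hl : (i l : ℕ) / 2 ^ t = (j l : ℕ) / 2 ^ t := congrFun h l
  push_cast at hi hj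
  rw [div_le_iff₀ h2, lt_div_iff₀ h2] at hi hj
  set a := (j l : ℕ) / 2 ^ t
  have hpos : 0 < 2 ^ t := by positivity
  have ei : a * 2 ^ t ≤ (i l : ℕ) := by rw [← hl]; exact Nat.div_mul_le_self _ _
  have ej : a * 2 ^ t ≤ (j l : ℕ) := Nat.div_mul_le_self _ _
  have fi : (i l : ℕ) + 1 ≤ a * 2 ^ t + 2 ^ t := by
    rw [← hl]; exact Nat.lt_div_mul_add hpos
  have fj : (j l : ℕ) + 1 ≤ a * 2 ^ t + 2 ^ t := Nat.lt_div_mul_add hpos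
  have ei' : (a : ℝ) * 2 ^ t ≤ (i l : ℕ) := by exact_mod_cast ei
  have ej' : (a : ℝ) * 2 ^ t ≤ (j l : ℕ) := by exact_mod_cast ej
  have fi' : ((i l : ℕ) : ℝ) + 1 ≤ a * 2 ^ t + 2 ^ t := by exact_mod_cast fi
  have fj' : ((j l : ℕ) : ℝ) + 1 ≤ a * 2 ^ t + 2 ^ t := by exact_mod_cast fj
  have hpow : (1 / 2 : ℝ) ^ (K - t) = 2 ^ t / 2 ^ K := by
    rw [one_div, inv_pow, eq_div_iff h2.ne', inv_mul_eq_iff_eq_mul₀ (by positivity), ← pow_add,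
      Nat.sub_add_cancel ht]
  have habs : |x l - y l| * 2 ^ K = |(x l - y l) * 2 ^ K| := by rw [abs_mul, abs_of_pos h2]
  rw [hpow, le_div_iff₀ h2, habs, sub_mul, abs_le]
  constructor <;> linarith

/-- Multiscale upper bound for the Wasserstein distance between a measure on the cube and a discrete
measure charging one point in each dyadic bin. -/
lemma wassersteinLp_le_multiscale {p v : ℝ} (hp : 1 ≤ p) (hv : 1 ≤ v) {d K : ℕ}
    (μ : Measure (Fin d → ℝ)) [IsProbabilityMeasure μ] (hμ : μ (cube d) = 1)
    (x : (Fin d → Fin (2 ^ K)) → Fin d → ℝ) (hx : ∀ j, x j ∈ binSet d (2 ^ K) j)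
    (w : (Fin d → Fin (2 ^ K)) → ℝ) (hw : ∀ j, 0 ≤ w j) (hw1 : ∑ j, w j = 1) :
    wassersteinLp p v μ (∑ j, ENNReal.ofReal (w j) • Measure.dirac (x j)) ≤
      (((d : ℝ) ^ (1 / p)) ^ v * (((1 / 2 : ℝ) ^ v) ^ K + ∑ t ∈ Finset.range K,
        ((1 / 2 : ℝ) ^ v) ^ (K - (t + 1)) *
          fiberDiscrepancy (dyadicAncestor d K t) (fun i => μ.real (binSet d (2 ^ K) i)) w)) ^
        (1 / v) := by
  have hp0 : 0 < p := by linarith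
  have hv0 : 0 < v := by linarith
  set D : ℝ := ((d : ℝ) ^ (1 / p)) ^ v with hD
  have hD0 : 0 ≤ D := by positivity
  set θ : ℝ := (1 / 2 : ℝ) ^ v with hθ
  have hθ0 : 0 ≤ θ := by positivity
  set m : (Fin d → Fin (2 ^ K)) → ℝ := fun i => μ.real (binSet d (2 ^ K) i) with hm
  have hdisj : Pairwise (Function.onFun Disjoint (binSet d (2 ^ K))) := fun i j hij =>
    Set.disjoint_left.2 fun y hi hj => hij (eq_of_mem_binSet hi hj)
  have hcov : ∀ᵐ y ∂μ, ∃ i, y ∈ binSet d (2 ^ K) i := by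
    filter_upwards [ae_mem_cube μ hμ] with y hy
    exact exists_mem_binSet_of_mem_cube (by positivity) hy
  have hm1 : ∑ i, m i = 1 := by
    rw [← measureReal_iUnion_fintype hdisj fun i => measurableSet_binSet _ _ i]
    have : μ (⋃ i, binSet d (2 ^ K) i) = 1 := by
      rw [← mem_ae_iff_prob_eq_one (MeasurableSet.iUnion fun i => measurableSet_binSet _ _ i)]
      filter_upwards [hcov] with y hy
      exact Set.mem_iUnion.2 hy
    rw [measureReal_def, this, ENNReal.toReal_one]
  set c : (Fin d → Fin (2 ^ K)) → (Fin d → Fin (2 ^ K)) → ℝ := fun i j =>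
    ⨆ y : binSet d (2 ^ K) i, lpDist p y (x j) ^ v with hc
  have hcδ : ∀ t i j, dyadicAncestor d K t i = dyadicAncestor d K t j →
      ∀ y ∈ binSet d (2 ^ K) i, lpDist p y (x j) ^ v ≤ D * θ ^ (K - t) := by
    intro t i j h y hy
    have h1 := lpDist_le hp0 (by positivity) fun l => abs_sub_le_of_dyadicAncestor_eq h hy (hx j) l
    refine (Real.rpow_le_rpow (lpDist_nonneg _ _ _) h1 hv0.le).trans (le_of_eq ?_)
    rw [Real.mul_rpow (by positivity) (by positivity), hD, hθ]
    congr 1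
    rw [← Real.rpow_natCast, ← Real.rpow_natCast, ← Real.rpow_mul (by norm_num),
      ← Real.rpow_mul (by norm_num), mul_comm]
  have hc0 : ∀ i j, 0 ≤ c i j := fun i j =>
    Real.iSup_nonneg fun y => Real.rpow_nonneg (lpDist_nonneg _ _ _) _
  have hcle : ∀ i j, ∀ y ∈ binSet d (2 ^ K) i, lpDist p y (x j) ^ v ≤ c i j := by
    intro i j y hy
    refine le_ciSup (f := fun y : binSet d (2 ^ K) i => lpDist p y (x j) ^ v)
      ⟨D * θ ^ (K - K), ?_⟩ ⟨y, hy⟩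
    rintro _ ⟨z, rfl⟩
    exact hcδ K i j (by rw [dyadicAncestor_self, dyadicAncestor_self]) z z.2
  obtain ⟨q, q0, hrow, hcol, hcost⟩ := exists_hierarchical_coupling (dyadicAncestor d K)
    (fun t i j h => dyadicAncestor_succ h) m w (fun i => measureReal_nonneg) hw
    (hm1.trans hw1.symm) c (fun t => D * θ ^ (K - t)) (fun t => by positivity)
    (fun t i j h => Real.iSup_le (fun y => hcδ t i j h y y.2) (by positivity)) K
    (fun i j => by rw [dyadicAncestor_self, dyadicAncestor_self])
  refine (wassersteinLp_le_of_coupling hv0 μ (binSet d (2 ^ K))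
    (fun i => measurableSet_binSet _ _ i) hdisj hcov x w c hcle hc0 q q0 hrow hcol).trans ?_
  refine Real.rpow_le_rpow (Finset.sum_nonneg fun i _ => Finset.sum_nonneg fun j _ =>
    mul_nonneg (q0 i j) (hc0 i j)) (hcost.trans (le_of_eq ?_)) (by positivity)
  rw [hm1, mul_add, Finset.mul_sum, Nat.sub_zero, mul_one]
  congr 1
  exact Finset.sum_congr rfl fun t _ => by ring

lemma fiberDiscrepancy_le_add {ι β : Type*} [Fintype ι] (g : ι → β) (m u w : ι → ℝ) :
    fiberDiscrepancy g m w ≤ fiberDiscrepancy g m u + ∑ i, |u i - w i| := by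
  unfold fiberDiscrepancy
  rw [← Finset.sum_fiberwise_of_maps_to (s := Finset.univ) (t := Finset.univ.image g) (g := g)
    (f := fun i => |u i - w i|) (fun i _ => Finset.mem_image_of_mem g (Finset.mem_univ i)),
    ← Finset.sum_add_distrib]
  refine Finset.sum_le_sum fun b _ => (abs_sub_le _ _ _).trans (add_le_add le_rfl ?_)
  rw [← Finset.sum_sub_distrib]
  exact Finset.abs_sum_le_sum_abs _ _

lemma sum_abs_sub_postWeight_le {d b n : ℕ} (hn : 0 < n) (α : (Fin d → Fin b) → ℝ)
    (hα : ∀ j, 0 ≤ α j) (Y : Fin n → Fin d → ℝ) (hN : ∑ j, (binCount d b Y j : ℝ) = n) :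
    ∑ j, |(binCount d b Y j : ℝ) / n - postWeight d b α Y j| ≤ 2 * (∑ j, α j) / n := by
  have hn' : (0 : ℝ) < n := by exact_mod_cast hn
  set S := ∑ j, α j with hS
  have hS0 : 0 ≤ S := Finset.sum_nonneg fun j _ => hα j
  calc ∑ j, |(binCount d b Y j : ℝ) / n - postWeight d b α Y j|
      ≤ ∑ j, ((binCount d b Y j : ℝ) * (S / n) + α j) / n := by
        refine Finset.sum_le_sum fun j _ => ?_
        have e : (binCount d b Y j : ℝ) / n - postWeight d b α Y j =
            (binCount d b Y j * (S / n) - α j) / (n + S) := by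
          unfold postWeight
          rw [← hS]
          field_simp
          ring
        rw [e, abs_div, abs_of_pos (by linarith : (0 : ℝ) < n + S)]
        have hN0 : (0 : ℝ) ≤ binCount d b Y j * (S / n) := by positivity
        refine div_le_div₀ (add_nonneg hN0 (hα j)) ?_ hn' (by linarith)
        rw [abs_le]
        constructor <;> linarith [hα j]
    _ = 2 * S / n := by
        rw [← Finset.sum_div, Finset.sum_add_distrib, ← Finset.sum_mul, hN, ← hS,
          mul_div_cancel₀ _ hn'.ne']
        ring

lemma sum_postWeight {d b n : ℕ} (hn : 0 < n) (α : (Fin d → Fin b) → ℝ)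
    (hα : ∀ j, 0 ≤ α j) (Y : Fin n → Fin d → ℝ) (hN : ∑ j, (binCount d b Y j : ℝ) = n) :
    ∑ j, postWeight d b α Y j = 1 := by
  have hn' : (0 : ℝ) < n := by exact_mod_cast hn
  have hS0 : 0 ≤ ∑ j, α j := Finset.sum_nonneg fun j _ => hα j
  unfold postWeight
  rw [← Finset.sum_div, Finset.sum_add_distrib, hN, add_comm, div_self (by linarith)]

lemma sum_binCount {d b n : ℕ} (hb : 0 < b) (Y : Fin n → Fin d → ℝ) (hY : ∀ t, Y t ∈ cube d) :
    ∑ j, (binCount d b Y j : ℝ) = n := by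
  choose f hf using fun t => exists_mem_binSet_of_mem_cube hb (hY t)
  have h : ∀ j, binCount d b Y j = (Finset.univ.filter fun t => f t = j).card := by
    intro j
    unfold binCount
    congr 1
    ext t
    simp only [Finset.mem_filter, Finset.mem_univ, true_and]
    exact ⟨fun h => eq_of_mem_binSet (hf t) h, fun h => h ▸ hf t⟩
  have := Finset.card_eq_sum_card_fiberwise (f := f) (s := Finset.univ) (t := Finset.univ)
    (fun _ _ => Finset.mem_coe.2 (Finset.mem_univ _))
  rw [Finset.card_univ, Fintype.card_fin] at this
  simp only [h]
  exact_mod_cast this.symm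

/-- Mean squared error of an empirical average of a `[0, 1]`-valued function. -/
lemma integrable_and_integral_sq_sub_average_le {X : Type*} [MeasurableSpace X] (μ : Measure X)
    [IsProbabilityMeasure μ] {f : X → ℝ} (hf : Measurable f) (h0 : ∀ y, 0 ≤ f y)
    (h1 : ∀ y, f y ≤ 1) {n : ℕ} (hn : 0 < n) :
    Integrable (fun Y : Fin n → X => (∫ y, f y ∂μ - (∑ t, f (Y t)) / n) ^ 2)
        (Measure.pi fun _ => μ) ∧
      ∫ Y : Fin n → X, (∫ y, f y ∂μ - (∑ t, f (Y t)) / n) ^ 2 ∂(Measure.pi fun _ => μ) ≤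
        (∫ y, f y ∂μ) / n := by
  have hn' : (0 : ℝ) < n := by exact_mod_cast hn
  have hmem : MemLp f 2 μ :=
    memLp_of_bounded (Eventually.of_forall fun y => ⟨h0 y, h1 y⟩) hf.aestronglyMeasurable 2
  set m := ∫ y, f y ∂μ with hm
  have hm0 : 0 ≤ m := integral_nonneg h0
  set F : (Fin n → X) → ℝ := ∑ t, fun Y => f (Y t) with hF
  have hFY : ∀ Y, F Y = ∑ t, f (Y t) := fun Y => by simp [hF]
  have hmemt : ∀ t : Fin n, MemLp (fun Y : Fin n → X => f (Y t)) 2 (Measure.pi fun _ => μ) :=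
    fun t => hmem.comp_measurePreserving (measurePreserving_eval _ t)
  have hFm : MemLp F 2 (Measure.pi fun _ => μ) := memLp_finsetSum' _ fun t _ => hmemt t
  have hint : ∫ Y, F Y ∂(Measure.pi fun _ => μ) = n * m := by
    simp only [hFY]
    rw [integral_finsetSum _ fun t _ => (hmemt t).integrable (by norm_num)]
    have : ∀ t : Fin n, ∫ Y : Fin n → X, f (Y t) ∂(Measure.pi fun _ => μ) = m := by
      intro t
      have h := integral_map (μ := Measure.pi fun _ : Fin n => μ) (φ := Function.eval t)
        (measurable_pi_apply t).aemeasurable hf.aestronglyMeasurable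
      rw [(measurePreserving_eval (fun _ : Fin n => μ) t).map_eq] at h
      exact h.symm
    simp [this]
  have hvar : ProbabilityTheory.variance F (Measure.pi fun _ => μ) ≤ n * m := by
    rw [hF, ProbabilityTheory.variance_sum_pi (X := fun _ : Fin n => f) fun _ => hmem]
    simp only [Finset.sum_const, Finset.card_univ, Fintype.card_fin, nsmul_eq_mul]
    gcongr
    refine (ProbabilityTheory.variance_le_sub_mul_sub (a := 0) (b := 1)
      (Eventually.of_forall fun y => ⟨h0 y, h1 y⟩) hf.aemeasurable).trans ?_
    rw [← hm]
    nlinarith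
  have hrew : (fun Y : Fin n → X => (m - (∑ t, f (Y t)) / n) ^ 2) =
      fun Y => (1 / (n : ℝ) ^ 2) * (F Y - n * m) ^ 2 := by
    funext Y
    rw [hFY]
    field_simp
    ring
  rw [hrew]
  constructor
  · exact ((hFm.sub (memLp_const _)).integrable_sq).const_mul _
  · rw [integral_const_mul, ← hint,
      ← ProbabilityTheory.variance_eq_integral hFm.aestronglyMeasurable.aemeasurable]
    calc _ ≤ 1 / (n : ℝ) ^ 2 * (n * m) := by gcongr
      _ = m / n := by field_simp

lemma sum_binCount_eq {d b n : ℕ} (F : Finset (Fin d → Fin b)) (Y : Fin n → Fin d → ℝ) :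
    ∑ i ∈ F, (binCount d b Y i : ℝ) =
      ∑ t, ∑ i ∈ F, Set.indicator (binSet d b i) (fun _ => (1 : ℝ)) (Y t) := by
  rw [Finset.sum_comm]
  refine Finset.sum_congr rfl fun i _ => ?_
  simp [binCount, Set.indicator_apply]

/-- The discrepancy at a given resolution between the law and the empirical frequencies has an
integrable upper bound of order `√(M / n)`, where `M` bounds the number of cells. -/
lemma exists_integrable_bound_fiberDiscrepancy {d b n : ℕ} (hn : 0 < n) {β : Type*}
    (g : (Fin d → Fin b) → β) (μ : Measure (Fin d → ℝ)) [IsProbabilityMeasure μ] {M : ℝ}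
    (hM : 0 < M) (hcard : ((Finset.univ.image g).card : ℝ) ≤ M) :
    ∃ G : (Fin n → Fin d → ℝ) → ℝ, Integrable G (Measure.pi fun _ => μ) ∧
      (∀ Y, fiberDiscrepancy g (fun i => μ.real (binSet d b i))
        (fun i => (binCount d b Y i : ℝ) / n) ≤ G Y) ∧
      ∫ Y, G Y ∂(Measure.pi fun _ => μ) ≤ √(M / n) := by
  have hn' : (0 : ℝ) < n := by exact_mod_cast hn
  set F : β → Finset (Fin d → Fin b) := fun a => Finset.univ.filter fun i => g i = a with hF
  set f : β → (Fin d → ℝ) → ℝ := fun a y =>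
    ∑ i ∈ F a, Set.indicator (binSet d b i) (fun _ => (1 : ℝ)) y with hf
  have hfm : ∀ a, Measurable (f a) := fun a => Finset.measurable_sum _ fun i _ =>
    measurable_const.indicator (measurableSet_binSet _ _ i)
  have hf0 : ∀ a y, 0 ≤ f a y := fun a y => Finset.sum_nonneg fun i _ =>
    Set.indicator_nonneg (fun _ _ => zero_le_one) _
  have hf1 : ∀ a y, f a y ≤ 1 := by
    intro a y
    by_cases h : ∃ i, y ∈ binSet d b i
    · obtain ⟨i, hi⟩ := h
      have h1 : f a y ≤ ∑ k, Set.indicator (binSet d b k) (fun _ => (1 : ℝ)) y :=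
        Finset.sum_le_univ_sum_of_nonneg fun k => Set.indicator_nonneg (fun _ _ => zero_le_one) _
      rw [Finset.sum_eq_single i (fun k _ hk => Set.indicator_of_notMem
        (fun h => hk (eq_of_mem_binSet h hi)) _) (by simp)] at h1
      simpa [hi] using h1
    · push Not at h
      simp [hf, h]
  have hfint : ∀ a, ∫ y, f a y ∂μ = ∑ i ∈ F a, μ.real (binSet d b i) := by
    intro a
    simp only [hf]
    rw [integral_finsetSum _ fun i _ =>
      (integrable_const (1 : ℝ)).indicator (measurableSet_binSet _ _ i)]
    exact Finset.sum_congr rfl fun i _ => integral_indicator_one (measurableSet_binSet _ _ i)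
  have hV := fun a => integrable_and_integral_sq_sub_average_le μ (hfm a) (hf0 a) (hf1 a) hn
  set ε : ℝ := 1 / √(n * M) with hε
  have hnM : 0 < √(n * M) := Real.sqrt_pos.2 (by positivity)
  have hε0 : 0 < ε := by positivity
  set V : β → (Fin n → Fin d → ℝ) → ℝ := fun a Y =>
    (∫ y, f a y ∂μ - (∑ t, f a (Y t)) / n) ^ 2 with hVdef
  have hVint : Integrable (fun Y => ∑ a ∈ Finset.univ.image g, V a Y)
      (Measure.pi fun _ : Fin n => μ) := integrable_finsetSum _ fun a _ => (hV a).1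
  refine ⟨fun Y => (1 / 2) * ((1 / ε) * ∑ a ∈ Finset.univ.image g, V a Y + M * ε), ?_, ?_, ?_⟩
  · exact ((hVint.const_mul _).add (integrable_const _)).const_mul _
  · intro Y
    have hcardε : ∑ _a ∈ Finset.univ.image g, ε ≤ M * ε := by
      rw [Finset.sum_const, nsmul_eq_mul]
      gcongr
    have hpt : ∀ a, |∑ i ∈ F a, μ.real (binSet d b i) - ∑ i ∈ F a, (binCount d b Y i : ℝ) / n| ≤
        (1 / 2) * ((1 / ε) * V a Y + ε) := by
      intro a
      rw [← Finset.sum_div, sum_binCount_eq, ← hfint]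
      set z := ∫ y, f a y ∂μ - (∑ t, f a (Y t)) / n with hz
      change |z| ≤ (1 / 2) * ((1 / ε) * z ^ 2 + ε)
      have h1 : 0 ≤ (1 / ε) * (|z| - ε) ^ 2 := by positivity
      have h2 : (1 / ε) * (|z| - ε) ^ 2 = (1 / ε) * z ^ 2 - 2 * |z| + ε := by
        rw [sub_sq, sq_abs]
        field_simp
      linarith
    calc _ ≤ ∑ a ∈ Finset.univ.image g, (1 / 2) * ((1 / ε) * V a Y + ε) :=
          Finset.sum_le_sum fun a _ => hpt a
      _ = (1 / 2) * ((1 / ε) * ∑ a ∈ Finset.univ.image g, V a Y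
            + ∑ _a ∈ Finset.univ.image g, ε) := by
          rw [← Finset.mul_sum, Finset.sum_add_distrib, ← Finset.mul_sum]
      _ ≤ _ := mul_le_mul_of_nonneg_left (add_le_add le_rfl hcardε) (by norm_num)
  · rw [integral_const_mul, integral_add (hVint.const_mul _) (integrable_const _),
      integral_const_mul, integral_finsetSum _ fun a _ => (hV a).1]
    have hsum : ∑ a ∈ Finset.univ.image g, ∫ Y, V a Y ∂(Measure.pi fun _ : Fin n => μ) ≤ 1 / n := by
      calc _ ≤ ∑ a ∈ Finset.univ.image g, (∫ y, f a y ∂μ) / n :=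
            Finset.sum_le_sum fun a _ => (hV a).2
        _ = (∑ i, μ.real (binSet d b i)) / n := by
            rw [← Finset.sum_div]
            simp only [hfint]
            rw [Finset.sum_fiberwise_of_maps_to
              fun i _ => Finset.mem_image_of_mem g (Finset.mem_univ i)]
        _ ≤ 1 / n := by
            gcongr
            rw [← measureReal_iUnion_fintype (fun i j hij => Set.disjoint_left.2
              fun y hi hj => hij (eq_of_mem_binSet hi hj)) fun i => measurableSet_binSet _ _ i]
            exact measureReal_le_one
    have hconst : ∫ _ : Fin n → Fin d → ℝ, M * ε ∂(Measure.pi fun _ => μ) = M * ε := by simp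
    rw [hconst]
    have hs : √(n * M) * √(n * M) = n * M := Real.mul_self_sqrt (by positivity)
    have hroot : √(M / n) = √(n * M) / n := by
      rw [Real.sqrt_eq_iff_mul_self_eq_of_pos (by positivity), div_mul_div_comm, hs]
      field_simp
    calc _ ≤ (1 / 2) * ((1 / ε) * (1 / n) + M * ε) := by gcongr
      _ = √(M / n) := by
        rw [hroot, hε]
        field_simp
        nlinarith

lemma rpow_le_of_pos_scale {v a z : ℝ} (hv : 1 ≤ v) (ha : 0 < a) (hz : 0 ≤ z) :
    z ^ (1 / v) ≤ a ^ (1 / v) * (1 + z / a) := by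
  have hv0 : 0 < v := by linarith
  have h1 : z ^ (1 / v) = a ^ (1 / v) * (z / a) ^ (1 / v) := by
    rw [← Real.mul_rpow ha.le (by positivity), mul_div_cancel₀ _ ha.ne']
  rw [h1]
  gcongr
  have hza : 0 ≤ z / a := by positivity
  calc (z / a) ^ (1 / v) ≤ (1 + z / a) ^ (1 / v) :=
        Real.rpow_le_rpow hza (by linarith) (by positivity)
    _ ≤ (1 + z / a) ^ (1 : ℝ) :=
        Real.rpow_le_rpow_of_exponent_le (by linarith) (by rw [div_le_one hv0]; exact hv)
    _ = 1 + z / a := Real.rpow_one _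

/-- Multiscale bound for the expected Wasserstein risk of the discretized histogram. -/
lemma integral_wassersteinLp_discretizedHist_le {p v : ℝ} (hp : 1 ≤ p) (hv : 1 ≤ v) {d K n : ℕ}
    (hn : 0 < n) (μ : Measure (Fin d → ℝ)) [IsProbabilityMeasure μ] (hμ : μ (cube d) = 1)
    (x : (Fin d → Fin (2 ^ K)) → Fin d → ℝ) (hx : ∀ j, x j ∈ binSet d (2 ^ K) j)
    (α : (Fin d → Fin (2 ^ K)) → ℝ) (hα : ∀ j, 0 ≤ α j) {a : ℝ} (ha : 0 < a)
    (hle : ((d : ℝ) ^ (1 / p)) ^ v * (((1 / 2 : ℝ) ^ v) ^ K + ∑ k ∈ Finset.range K,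
        ((1 / 2 : ℝ) ^ v) ^ k * (2 * (∑ j, α j) / n + √(2 ^ d) ^ (k + 1) / √n)) ≤ a) :
    ∫ Y, wassersteinLp p v μ (discretizedHist d (2 ^ K) α Y x) ∂(Measure.pi fun _ : Fin n => μ) ≤
      2 * a ^ (1 / v) := by
  have hn' : (0 : ℝ) < n := by exact_mod_cast hn
  set D : ℝ := ((d : ℝ) ^ (1 / p)) ^ v with hD
  have hD0 : 0 ≤ D := by positivity
  set θ : ℝ := (1 / 2 : ℝ) ^ v with hθ
  have hθ0 : 0 ≤ θ := by positivity
  set S := ∑ j, α j with hS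
  have hbound : ∀ t, ∃ G : (Fin n → Fin d → ℝ) → ℝ, Integrable G (Measure.pi fun _ => μ) ∧
      (t < K → (∀ Y, fiberDiscrepancy (dyadicAncestor d K t)
        (fun i => μ.real (binSet d (2 ^ K) i)) (fun i => (binCount d (2 ^ K) Y i : ℝ) / n) ≤ G Y) ∧
      ∫ Y, G Y ∂(Measure.pi fun _ => μ) ≤ √(2 ^ d) ^ (K - t) / √n) := by
    intro t
    by_cases ht : t < K
    · obtain ⟨G, h1, h2, h3⟩ := exists_integrable_bound_fiberDiscrepancy hn (dyadicAncestor d K t) μ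
        (M := (2 ^ d) ^ (K - t)) (by positivity)
        (by
          have h := card_image_dyadicAncestor_le d K t ht.le
          norm_cast
          convert h)
      refine ⟨G, h1, fun _ => ⟨h2, h3.trans (le_of_eq ?_)⟩⟩
      rw [Real.sqrt_div (by positivity)]
      congr 1
      rw [Real.sqrt_eq_iff_mul_self_eq_of_pos (by positivity), ← mul_pow,
        Real.mul_self_sqrt (by positivity)]
    · exact ⟨0, integrable_zero _ _ _, fun h => absurd h ht⟩
  choose G hGint hG using hbound
  set Z : (Fin n → Fin d → ℝ) → ℝ := fun Y => D * (θ ^ K + ∑ t ∈ Finset.range K,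
    θ ^ (K - (t + 1)) * (G t Y + 2 * S / n)) with hZ
  have hterm : ∀ t, Integrable (fun Y => θ ^ (K - (t + 1)) * (G t Y + 2 * S / n))
      (Measure.pi fun _ : Fin n => μ) := fun t =>
    ((hGint t).add (integrable_const _)).const_mul _
  have hsumint : Integrable (fun Y => ∑ t ∈ Finset.range K,
      θ ^ (K - (t + 1)) * (G t Y + 2 * S / n)) (Measure.pi fun _ : Fin n => μ) :=
    integrable_finsetSum _ fun t _ => hterm t
  have hZint : Integrable Z (Measure.pi fun _ : Fin n => μ) :=
    ((integrable_const _).add hsumint).const_mul _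
  have hZle : ∫ Y, Z Y ∂(Measure.pi fun _ : Fin n => μ) ≤ a := by
    refine le_trans ?_ hle
    simp only [hZ]
    rw [integral_const_mul, integral_add (integrable_const _) hsumint,
      integral_finsetSum _ fun t _ => hterm t]
    refine mul_le_mul_of_nonneg_left (add_le_add (by simp) ?_) hD0
    rw [← Finset.sum_range_reflect fun k => θ ^ k * (2 * S / n + √(2 ^ d) ^ (k + 1) / √n)]
    refine Finset.sum_le_sum fun t ht => ?_
    have ht' := Finset.mem_range.1 ht
    rw [integral_const_mul, integral_add (hGint t) (integrable_const _)]
    have e1 : K - 1 - t = K - (t + 1) := by omega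
    have e2 : K - (t + 1) + 1 = K - t := by omega
    rw [e1, e2]
    refine mul_le_mul_of_nonneg_left ?_ (by positivity)
    have := ((hG t ht').2)
    simp only [integral_const, probReal_univ, one_smul]
    linarith
  have hae : ∀ᵐ Y ∂(Measure.pi fun _ : Fin n => μ), ∀ t, Y t ∈ cube d := by
    rw [ae_all_iff]
    intro t
    exact (measurePreserving_eval (fun _ : Fin n => μ) t).quasiMeasurePreserving.ae
      (ae_mem_cube μ hμ)
  have hpt : ∀ᵐ Y ∂(Measure.pi fun _ : Fin n => μ),
      wassersteinLp p v μ (discretizedHist d (2 ^ K) α Y x) ≤ a ^ (1 / v) * (1 + Z Y / a) := by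
    filter_upwards [hae] with Y hY
    have hN := sum_binCount (b := 2 ^ K) (by positivity) Y hY
    have hS0 : 0 ≤ S := Finset.sum_nonneg fun j _ => hα j
    have hw0 : ∀ j, 0 ≤ postWeight d (2 ^ K) α Y j := fun j =>
      div_nonneg (add_nonneg (hα j) (Nat.cast_nonneg _)) (by rw [← hS]; linarith)
    refine (wassersteinLp_le_multiscale hp hv μ hμ x hx _ hw0 (sum_postWeight hn α hα Y hN)).trans ?_
    refine (rpow_le_of_pos_scale hv ha (mul_nonneg hD0 (add_nonneg (by positivity)
      (Finset.sum_nonneg fun t _ => mul_nonneg (by positivity)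
        (fiberDiscrepancy_nonneg _ _ _))))).trans ?_
    refine mul_le_mul_of_nonneg_left (add_le_add le_rfl (div_le_div_of_nonneg_right ?_ ha.le))
      (by positivity)
    refine mul_le_mul_of_nonneg_left (add_le_add le_rfl (Finset.sum_le_sum fun t ht => ?_)) hD0
    refine mul_le_mul_of_nonneg_left ?_ (by positivity)
    exact (fiberDiscrepancy_le_add _ _ _ _).trans (add_le_add
      ((hG t (Finset.mem_range.1 ht)).1 Y) (sum_abs_sub_postWeight_le hn α hα Y hN))
  refine (integral_mono_of_nonneg (g := fun Y => a ^ (1 / v) * (1 + Z Y / a))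
    (Eventually.of_forall fun Y => wassersteinLp_nonneg _ _ _ _)
    (((integrable_const 1).add (hZint.div_const a)).const_mul _) hpt).trans ?_
  rw [integral_const_mul, integral_add (integrable_const _) (hZint.div_const a),
    integral_div]
  have h1 : (∫ Y, Z Y ∂(Measure.pi fun _ : Fin n => μ)) / a ≤ 1 := div_le_one_of_le₀ hZle ha.le
  have h2 : 0 ≤ a ^ (1 / v) := by positivity
  simp only [integral_const, probReal_univ, one_smul]
  nlinarith

/-- If every term of the multiscale bound is of order `r`, then the expected risk is of order
`r ^ (1 / v)`. -/
lemma integral_wassersteinLp_discretizedHist_le_rate {p v : ℝ} (hp : 1 ≤ p) (hv : 1 ≤ v)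
    {d K n : ℕ} (hd : 1 ≤ d) (hn : 0 < n) (μ : Measure (Fin d → ℝ)) [IsProbabilityMeasure μ]
    (hμ : μ (cube d) = 1)
    (x : (Fin d → Fin (2 ^ K)) → Fin d → ℝ) (hx : ∀ j, x j ∈ binSet d (2 ^ K) j)
    (α : (Fin d → Fin (2 ^ K)) → ℝ) (hα : ∀ j, 0 ≤ α j) {r c B : ℝ} (hr : 0 < r)
    (hc : 0 ≤ c) (hB : 0 ≤ B) (hK : ((1 / 2 : ℝ) ^ v) ^ K ≤ r) (hS : (∑ j, α j) / n ≤ c * r)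
    (hsum : (∑ k ∈ Finset.range K, ((2 : ℝ) ^ ((d : ℝ) / 2 - v)) ^ k) / √n ≤ B * r) :
    ∫ Y, wassersteinLp p v μ (discretizedHist d (2 ^ K) α Y x) ∂(Measure.pi fun _ : Fin n => μ) ≤
      2 * (((d : ℝ) ^ (1 / p)) ^ v * (1 + 4 * c + √(2 ^ d) * B)) ^ (1 / v) * r ^ (1 / v) := by
  have hn' : (0 : ℝ) < n := by exact_mod_cast hn
  have hd' : (0 : ℝ) < d := by exact_mod_cast hd
  have hη : √((2 : ℝ) ^ d) = 2 ^ ((d : ℝ) / 2) := by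
    rw [Real.sqrt_eq_rpow, ← Real.rpow_natCast, ← Real.rpow_mul (by norm_num)]
    ring_nf
  have hq : (1 / 2 : ℝ) ^ v * √(2 ^ d) = (2 : ℝ) ^ ((d : ℝ) / 2 - v) := by
    rw [hη, one_div, Real.inv_rpow (by norm_num), Real.rpow_sub (by norm_num)]
    field_simp
  have hA : 0 < ((d : ℝ) ^ (1 / p)) ^ v * (1 + 4 * c + √(2 ^ d) * B) := by positivity
  rw [mul_assoc, ← Real.mul_rpow hA.le hr.le]
  refine integral_wassersteinLp_discretizedHist_le hp hv hn μ hμ x hx α hα (mul_pos hA hr) ?_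
  rw [mul_assoc]
  refine mul_le_mul_of_nonneg_left ?_ (by positivity)
  have hsplit : ∑ k ∈ Finset.range K,
        ((1 / 2 : ℝ) ^ v) ^ k * (2 * (∑ j, α j) / n + √(2 ^ d) ^ (k + 1) / √n) =
      2 * ((∑ j, α j) / n) * ∑ k ∈ Finset.range K, ((1 / 2 : ℝ) ^ v) ^ k +
        √(2 ^ d) * ((∑ k ∈ Finset.range K, ((2 : ℝ) ^ ((d : ℝ) / 2 - v)) ^ k) / √n) := by
    generalize ∑ j, α j = S
    rw [← hq, Finset.sum_div, Finset.mul_sum, Finset.mul_sum, ← Finset.sum_add_distrib]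
    refine Finset.sum_congr rfl fun k _ => ?_
    rw [mul_pow, pow_succ]
    ring
  have hgeom : ∑ k ∈ Finset.range K, ((1 / 2 : ℝ) ^ v) ^ k ≤ 2 := by
    have hθ : (1 / 2 : ℝ) ^ v ≤ 1 / 2 := by
      simpa using Real.rpow_le_rpow_of_exponent_ge (by norm_num : (0 : ℝ) < 1 / 2)
        (by norm_num) hv
    calc _ ≤ ∑ k ∈ Finset.range K, (1 / 2 : ℝ) ^ k := by gcongr
      _ ≤ ∑' k : ℕ, (1 / 2 : ℝ) ^ k :=
        summable_geometric_two.sum_le_tsum _ fun k _ => by positivity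
      _ = 2 := tsum_geometric_two
  rw [hsplit]
  have h1 : 2 * ((∑ j, α j) / n) * ∑ k ∈ Finset.range K, ((1 / 2 : ℝ) ^ v) ^ k ≤
      2 * (c * r) * 2 := by gcongr
  have h2 := mul_le_mul_of_nonneg_left hsum (Real.sqrt_nonneg (2 ^ d))
  linarith

lemma one_le_kSeq (d : ℕ) {v : ℝ} (hv : 1 ≤ v) {n : ℕ} (hn : 0 < n) : 1 ≤ kSeq d v n := by
  have hn' : (1 : ℝ) ≤ n := by exact_mod_cast hn
  unfold kSeq
  split_ifs
  · exact Real.one_le_rpow hn' (by positivity)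
  · exact Real.one_le_rpow hn' (by positivity)

lemma kSeq_le_two_pow_KSeq (d : ℕ) {v : ℝ} (hv : 1 ≤ v) {n : ℕ} (hn : 0 < n) :
    kSeq d v n ≤ 2 ^ KSeq d v n := by
  have h := one_le_kSeq d hv hn
  rw [← Real.rpow_natCast, ← Real.logb_le_iff_le_rpow (by norm_num) (by linarith)]
  exact Nat.le_ceil _

lemma KSeq_le (d : ℕ) {v : ℝ} (hv : 1 ≤ v) {n : ℕ} (hn : 0 < n) :
    (KSeq d v n : ℝ) ≤ Real.logb 2 (kSeq d v n) + 1 :=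
  (Nat.ceil_lt_add_one (Real.logb_nonneg (by norm_num) (one_le_kSeq d hv hn))).le

lemma two_pow_KSeq_le (d : ℕ) {v : ℝ} (hv : 1 ≤ v) {n : ℕ} (hn : 0 < n) :
    (2 : ℝ) ^ KSeq d v n ≤ 2 * kSeq d v n := by
  have h := one_le_kSeq d hv hn
  rw [← Real.rpow_natCast, ← Real.le_logb_iff_rpow_le (by norm_num) (by linarith),
    Real.logb_mul (by norm_num) (by linarith), Real.logb_self_eq_one (by norm_num), add_comm]
  exact KSeq_le d hv hn

lemma half_rpow_pow_KSeq_le (d : ℕ) {v : ℝ} (hv : 1 ≤ v) {n : ℕ} (hn : 0 < n) :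
    ((1 / 2 : ℝ) ^ v) ^ KSeq d v n ≤ kSeq d v n ^ (-v) := by
  have h := one_le_kSeq d hv hn
  have e : ((1 / 2 : ℝ) ^ v) ^ KSeq d v n = ((2 : ℝ) ^ KSeq d v n) ^ (-v) := by
    rw [one_div, Real.inv_rpow (by norm_num), ← Real.rpow_neg (by norm_num), ← Real.rpow_natCast,
      ← Real.rpow_natCast, ← Real.rpow_mul (by norm_num), ← Real.rpow_mul (by norm_num), mul_comm]
  rw [e]
  exact Real.rpow_le_rpow_of_nonpos (by linarith) (kSeq_le_two_pow_KSeq d hv hn) (by linarith)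

/-- the discretization of the posterior mean histogram, placing each bin's mass at
an arbitrary point of the bin, satisfies the same expected Wasserstein-v rates as the histogram
itself in all three regimes. -/
theorem discretized_histogram_rates
    (d : ℕ) (hd : 1 ≤ d) (p v : ℝ) (hp : 1 ≤ p) (hv : 1 ≤ v)
    (α : ∀ n : ℕ, (Fin d → Fin (bSeq d v n)) → ℝ) (c : ℝ) (hc : 0 < c)
    (hα0 : ∀ n j, 0 ≤ α n j)
    (hαsum_le : (d : ℝ) ≤ 2 * v → ∀ n : ℕ, ∑ j, α n j ≤ c * (n : ℝ) ^ ((1 : ℝ) / 2))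
    (hαsum_gt : (d : ℝ) > 2 * v → ∀ n : ℕ, ∑ j, α n j ≤ c * (n : ℝ) ^ (1 - v / d))
    (x : ∀ n : ℕ, (Fin d → Fin (bSeq d v n)) → Fin d → ℝ)
    (hx : ∀ n j, x n j ∈ binSet d (bSeq d v n) j) :
    ∃ C > (0 : ℝ), ∃ N : ℕ, 2 ≤ N ∧ ∀ n ≥ N, ∀ P₀ : Measure (Fin d → ℝ),
      IsProbabilityMeasure P₀ → P₀ (cube d) = 1 →
      (((d : ℝ) < 2 * v →
          ∫ Y, wassersteinLp p v P₀ (discretizedHist d (bSeq d v n) (α n) Y (x n))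
              ∂(Measure.pi fun _ : Fin n => P₀)
            ≤ C * (n : ℝ) ^ (-(1 / (2 * v)))) ∧
        ((d : ℝ) = 2 * v →
          ∫ Y, wassersteinLp p v P₀ (discretizedHist d (bSeq d v n) (α n) Y (x n))
              ∂(Measure.pi fun _ : Fin n => P₀)
            ≤ C * (n : ℝ) ^ (-(1 / (2 * v))) * Real.log n ^ ((1 : ℝ) / v)) ∧
        ((d : ℝ) > 2 * v →
          ∫ Y, wassersteinLp p v P₀ (discretizedHist d (bSeq d v n) (α n) Y (x n))
              ∂(Measure.pi fun _ : Fin n => P₀)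
            ≤ C * (n : ℝ) ^ (-(1 / (d : ℝ))))) := by
  have hv0 : 0 < v := by linarith
  have hd' : (0 : ℝ) < d := by exact_mod_cast hd
  have hsqrt : ∀ n : ℕ, 0 < n → 1 / √(n : ℝ) = (n : ℝ) ^ (-(1 / 2) : ℝ) := fun n _ => by
    rw [Real.sqrt_eq_rpow, Real.rpow_neg (Nat.cast_nonneg n), one_div]
  have hkle : (d : ℝ) ≤ 2 * v → ∀ n : ℕ, kSeq d v n ^ (-v) = (n : ℝ) ^ (-(1 / 2) : ℝ) := by
    intro h n
    rw [kSeq, if_pos h, ← Real.rpow_mul (Nat.cast_nonneg n)]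
    congr 1
    field_simp
  have hSle : (d : ℝ) ≤ 2 * v → ∀ n : ℕ, 0 < n →
      (∑ j, α n j) / n ≤ c * (n : ℝ) ^ (-(1 / 2) : ℝ) := by
    intro h n hn
    have hn' : (0 : ℝ) < n := by exact_mod_cast hn
    rw [div_le_iff₀ hn']
    refine (hαsum_le h n).trans (le_of_eq ?_)
    rw [mul_assoc, ← Real.rpow_add_one hn'.ne']
    norm_num
  set D : ℝ := ((d : ℝ) ^ (1 / p)) ^ v with hD
  have hD0 : 0 < D := by positivity
  set q : ℝ := (2 : ℝ) ^ ((d : ℝ) / 2 - v) with hq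
  have hq0 : 0 < q := by positivity
  rcases lt_trichotomy (d : ℝ) (2 * v) with h | h | h
  · have hq1 : q < 1 := Real.rpow_lt_one_of_one_lt_of_neg (by norm_num) (by linarith)
    have hB : 0 ≤ 1 / (1 - q) := one_div_nonneg.2 (by linarith)
    refine ⟨2 * (D * (1 + 4 * c + √(2 ^ d) * (1 / (1 - q)))) ^ (1 / v), by positivity, 3,
      by norm_num, fun n hn P₀ hP hcube => ⟨fun _ => ?_, fun h' => absurd h' h.ne,
        fun h' => absurd h' (not_lt.2 h.le)⟩⟩
    have hn0 : 0 < n := by omega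
    have hn' : (0 : ℝ) < n := by exact_mod_cast hn0
    have hrate := integral_wassersteinLp_discretizedHist_le_rate (K := KSeq d v n) hp hv hd hn0 P₀
      hcube (x n) (hx n) (α n) (hα0 n) (r := (n : ℝ) ^ (-(1 / 2) : ℝ)) (by positivity) hc.le hB
      ((half_rpow_pow_KSeq_le d hv hn0).trans_eq (hkle h.le n)) (hSle h.le n hn0) (by
        rw [← hsqrt n hn0, ← mul_one_div]
        refine mul_le_mul_of_nonneg_right ?_ (by positivity)
        rw [one_div, ← tsum_geometric_of_lt_one hq0.le hq1]
        exact (summable_geometric_of_lt_one hq0.le hq1).sum_le_tsum _ fun k _ => by positivity)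
    refine hrate.trans (le_of_eq ?_)
    rw [← Real.rpow_mul hn'.le]
    congr 2
    field_simp
  · have hq1 : q = 1 := by rw [hq, h]; ring_nf; exact Real.rpow_zero 2
    refine ⟨2 * (D * (1 + 4 * c + √(2 ^ d) * 3)) ^ (1 / v), by positivity, 3,
      by norm_num, fun n hn P₀ hP hcube => ⟨fun h' => absurd h h'.ne, fun _ => ?_,
        fun h' => absurd h' (not_lt.2 h.le)⟩⟩
    have hn0 : 0 < n := by omega
    have hn' : (0 : ℝ) < n := by exact_mod_cast hn0
    have hlog : 1 ≤ Real.log n := by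
      rw [Real.le_log_iff_exp_le hn']
      have : (3 : ℝ) ≤ n := by exact_mod_cast hn
      linarith [Real.exp_one_lt_d9]
    have hpow0 : 0 < (n : ℝ) ^ (-(1 / 2) : ℝ) := by positivity
    have hpowle : (n : ℝ) ^ (-(1 / 2) : ℝ) ≤ (n : ℝ) ^ (-(1 / 2) : ℝ) * Real.log n :=
      le_mul_of_one_le_right hpow0.le hlog
    have hKlog : (KSeq d v n : ℝ) ≤ 3 * Real.log n := by
      have h1 := KSeq_le d hv hn0
      rw [kSeq, if_pos h.le, Real.logb_rpow_eq_mul_logb_of_pos hn', Real.logb] at h1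
      have h2 : Real.log n / Real.log 2 ≤ 2 * Real.log n := by
        rw [div_le_iff₀ (Real.log_pos (by norm_num))]
        nlinarith [Real.log_two_gt_d9]
      have h3 : 1 / (2 * v) ≤ 1 := by
        rw [div_le_one (by positivity)]
        linarith
      have h4 : 1 / (2 * v) * (Real.log n / Real.log 2) ≤ 1 * (2 * Real.log n) :=
        mul_le_mul h3 h2 (div_nonneg (by linarith) (Real.log_nonneg (by norm_num))) zero_le_one
      linarith
    have hrate := integral_wassersteinLp_discretizedHist_le_rate (K := KSeq d v n) hp hv hd hn0 P₀
      hcube (x n) (hx n) (α n) (hα0 n) (r := (n : ℝ) ^ (-(1 / 2) : ℝ) * Real.log n)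
      (B := 3) (by positivity) hc.le (by norm_num)
      (((half_rpow_pow_KSeq_le d hv hn0).trans_eq (hkle h.le n)).trans hpowle)
      ((hSle h.le n hn0).trans (mul_le_mul_of_nonneg_left hpowle hc.le)) (by
        rw [← hq, hq1, ← mul_one_div, hsqrt n hn0]
        simp only [one_pow, Finset.sum_const, Finset.card_range, nsmul_eq_mul, mul_one]
        calc _ ≤ 3 * Real.log n * (n : ℝ) ^ (-(1 / 2) : ℝ) := by gcongr
          _ = _ := by ring)
    refine hrate.trans (le_of_eq ?_)
    rw [Real.mul_rpow hpow0.le (by linarith), ← Real.rpow_mul hn'.le, ← mul_assoc]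
    congr 3
    field_simp
  · have hq1 : 1 < q := Real.one_lt_rpow (by norm_num) (by linarith)
    have hB : 0 ≤ q / (q - 1) := div_nonneg hq0.le (by linarith)
    refine ⟨2 * (D * (1 + 4 * c + √(2 ^ d) * (q / (q - 1)))) ^ (1 / v), by positivity, 3,
      by norm_num, fun n hn P₀ hP hcube => ⟨fun h' => absurd h (not_lt.2 h'.le),
        fun h' => absurd h' h.ne', fun _ => ?_⟩⟩
    have hn0 : 0 < n := by omega
    have hn' : (0 : ℝ) < n := by exact_mod_cast hn0
    have hk : kSeq d v n = (n : ℝ) ^ ((1 : ℝ) / d) := by rw [kSeq, if_neg (not_le.2 h)]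
    have hrate := integral_wassersteinLp_discretizedHist_le_rate (K := KSeq d v n) hp hv hd hn0 P₀
      hcube (x n) (hx n) (α n) (hα0 n) (r := (n : ℝ) ^ (-(v / d))) (by positivity) hc.le hB
      ((half_rpow_pow_KSeq_le d hv hn0).trans_eq (by
        rw [hk, ← Real.rpow_mul hn'.le]
        ring_nf))
      (by
        rw [div_le_iff₀ hn', mul_assoc, ← Real.rpow_add_one hn'.ne', neg_add_eq_sub]
        exact hαsum_gt h n)
      (by
        have hqK : q ^ KSeq d v n ≤ q * (n : ℝ) ^ (1 / 2 - v / d) := by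
          have e1 : q ^ KSeq d v n = ((2 : ℝ) ^ KSeq d v n) ^ ((d : ℝ) / 2 - v) := by
            rw [hq, ← Real.rpow_natCast, ← Real.rpow_natCast, ← Real.rpow_mul (by norm_num),
              ← Real.rpow_mul (by norm_num), mul_comm]
          rw [e1]
          refine (Real.rpow_le_rpow (by positivity) (two_pow_KSeq_le d hv hn0)
            (by linarith)).trans (le_of_eq ?_)
          rw [hk, Real.mul_rpow (by norm_num) (by positivity), ← Real.rpow_mul hn'.le]
          congr 2
          field_simp
        have hgeom : ∑ k ∈ Finset.range (KSeq d v n), q ^ k ≤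
            q / (q - 1) * (n : ℝ) ^ (1 / 2 - v / d) := by
          rw [geom_sum_eq hq1.ne', div_mul_eq_mul_div]
          exact div_le_div_of_nonneg_right (by linarith) (by linarith)
        rw [← mul_one_div, hsqrt n hn0]
        refine (mul_le_mul_of_nonneg_right hgeom (by positivity)).trans (le_of_eq ?_)
        rw [mul_assoc, ← Real.rpow_add hn']
        ring_nf)
    refine hrate.trans (le_of_eq ?_)
    rw [← Real.rpow_mul hn'.le]
    congr 2
    field_simp

end
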